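/- Let G = (V,E) be a finite simple graph with a co-comparability ordering ≺, let α = α(G), let d be an integer with 1 ≤ d ≤ α, and let I be a max-extendable independent set of G of size α − d + 1. For each v ∈ I, fix a maximum independent set I_v of G containing v. Then the map v ↦ pos_{I_v}(v) is an injective map from I into {1,…,α}, and consequently exactly d − 1 integers g ∈ {1,…,α} satisfy pos_{I_v}(v) ≠ g for all v ∈ I. -/

import Mathlib

/-- An independent set (as a finset): pairwise non-adjacent vertices. -/
def IsIndep {V : Type*} (G : SimpleGraph V) (I : Finset V) : Prop :=
  ∀ u ∈ I, ∀ v ∈ I, u ≠ v → ¬ G.Adj u v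

/-- The independence number `α(G)`: the maximum size of an independent set. -/
noncomputable def indepNum {V : Type*} (G : SimpleGraph V) : ℕ :=
  sSup {n | ∃ I : Finset V, IsIndep G I ∧ I.card = n}

/-- `pos_I(v) = |{u ∈ I : u ≺ v}| + 1`. -/
def posIn {V : Type*} [LinearOrder V] (I : Finset V) (v : V) : ℕ :=
  (I.filter fun u => u < v).card + 1

theorem IsIndep.card_le_indepNum {V : Type*} [Fintype V] {G : SimpleGraph V} {I : Finset V}
    (hI : IsIndep G I) : I.card ≤ indepNum G := by
  refine le_csSup ⟨Fintype.card V, ?_⟩ ⟨I, hI, rfl⟩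
  rintro n ⟨K, -, rfl⟩
  exact K.card_le_univ

/-- In a co-comparability ordering, the part of one independent set up to `v` and the part of
another one from `v` on combine to an independent set, provided both contain `v`. -/
theorem IsIndep.filter_le_union_filter_gt {V : Type*} [LinearOrder V] {G : SimpleGraph V}
    (hco : ∀ u v w : V, u < v → v < w → ¬ G.Adj u v → ¬ G.Adj v w → ¬ G.Adj u w)
    {A B : Finset V} (hA : IsIndep G A) (hB : IsIndep G B) {v : V} (hvA : v ∈ A) (hvB : v ∈ B) :
    IsIndep G ((A.filter fun u => u ≤ v) ∪ B.filter fun u => v < u) := by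
  have cross : ∀ x ∈ A, x ≤ v → ∀ y ∈ B, v < y → ¬ G.Adj x y := by
    intro x hx hxv y hy hvy
    rcases hxv.eq_or_lt with rfl | hxv
    · exact hB x hvB y hy hvy.ne
    · exact hco x v y hxv hvy (hA x hx v hvA hxv.ne) (hB v hvB y hy hvy.ne)
  intro x hx y hy hxy
  simp only [Finset.mem_union, Finset.mem_filter] at hx hy
  rcases hx with ⟨hx, hxv⟩ | ⟨hx, hxv⟩ <;> rcases hy with ⟨hy, hyv⟩ | ⟨hy, hyv⟩
  · exact hA x hx y hy hxy
  · exact cross x hx hxv y hy hyv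
  · exact fun h => cross y hy hyv x hx hxv h.symm
  · exact hB x hx y hy hxy

theorem card_filter_le_eq_posIn {V : Type*} [LinearOrder V] {A : Finset V} {v : V}
    (hv : v ∈ A) : (A.filter fun u => u ≤ v).card = posIn A v := by
  have h : (A.filter fun u => u ≤ v) = insert v (A.filter fun u => u < v) := by
    ext x
    simp only [Finset.mem_filter, Finset.mem_insert, le_iff_lt_or_eq]
    grind
  rw [h, Finset.card_insert_of_notMem (by simp), posIn]

theorem posIn_le_card {V : Type*} [LinearOrder V] {A : Finset V} {v : V} (hv : v ∈ A) :
    posIn A v ≤ A.card := by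
  rw [← card_filter_le_eq_posIn hv]
  exact Finset.card_filter_le _ _

theorem posIn_injOn {V : Type*} [LinearOrder V] (A : Finset V) :
    Set.InjOn (posIn A) A := by
  have mono : ∀ u ∈ A, ∀ v, u < v → posIn A u < posIn A v := by
    intro u hu v huv
    refine Nat.succ_lt_succ (Finset.card_lt_card (Finset.ssubset_iff_of_subset ?_ |>.2
      ⟨u, by simp [hu, huv], by simp⟩))
    exact Finset.monotone_filter_right A fun x _ hx => hx.trans huv
  intro u hu v hv huv
  rcases lt_trichotomy u v with h | h | h
  · exact absurd huv (mono u hu v h).ne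
  · exact h
  · exact absurd huv (mono v hv u h).ne'

theorem IsIndep.posIn_le_posIn {V : Type*} [Fintype V] [LinearOrder V] {G : SimpleGraph V}
    (hco : ∀ u v w : V, u < v → v < w → ¬ G.Adj u v → ¬ G.Adj v w → ¬ G.Adj u w)
    {A B : Finset V} (hA : IsIndep G A) (hB : IsIndep G B) (hBcard : B.card = indepNum G)
    {v : V} (hvA : v ∈ A) (hvB : v ∈ B) : posIn A v ≤ posIn B v := by
  have h := (hA.filter_le_union_filter_gt hco hB hvA hvB).card_le_indepNum
  rw [Finset.card_union_of_disjoint, card_filter_le_eq_posIn hvA, ← hBcard,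
    ← Finset.card_filter_add_card_filter_not (s := B) fun u => u ≤ v,
    card_filter_le_eq_posIn hvB] at h
  · simpa using h
  · refine Finset.disjoint_left.2 fun x hx hx' => ?_
    exact (Finset.mem_filter.1 hx).2.not_gt (Finset.mem_filter.1 hx').2

/-- In a finite graph with a co-comparability ordering, with
`1 ≤ d ≤ α(G)`, let `I` be a max-extendable independent set of size `α(G) - d + 1`
(i.e. contained in a maximum independent set `J`), and for each `v ∈ I` fix a maximum
independent set `f v` containing `v`. Then `v ↦ pos_{f v}(v)` is injective on `I`,
takes values in `{1, …, α(G)}`, and exactly `d - 1` integers `g ∈ {1, …, α(G)}`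
are avoided by it. -/
theorem stmt17 {V : Type*} [Fintype V] [LinearOrder V] (G : SimpleGraph V)
    (hco : ∀ u v w : V, u < v → v < w → ¬ G.Adj u v → ¬ G.Adj v w → ¬ G.Adj u w)
    (d : ℕ) (hd1 : 1 ≤ d) (hdα : d ≤ indepNum G)
    (I : Finset V) (hI : IsIndep G I) (hIcard : I.card = indepNum G - d + 1)
    (J : Finset V) (hJ : IsIndep G J) (hJcard : J.card = indepNum G) (hIJ : I ⊆ J)
    (f : V → Finset V)
    (hf : ∀ v ∈ I, IsIndep G (f v) ∧ (f v).card = indepNum G ∧ v ∈ f v) :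
    Set.InjOn (fun v => posIn (f v) v) ↑I ∧
    (∀ v ∈ I, posIn (f v) v ∈ Finset.Icc 1 (indepNum G)) ∧
    ((Finset.Icc 1 (indepNum G)).filter
        (fun g => ∀ v ∈ I, posIn (f v) v ≠ g)).card = d - 1 := by
  have pos_eq : ∀ v ∈ I, posIn (f v) v = posIn J v := by
    intro v hv
    obtain ⟨hind, hcard, hmem⟩ := hf v hv
    exact le_antisymm (hind.posIn_le_posIn hco hJ hJcard hmem (hIJ hv))
      (hJ.posIn_le_posIn hco hind hcard (hIJ hv) hmem)
  have inj : Set.InjOn (fun v => posIn (f v) v) ↑I :=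
    ((posIn_injOn J).mono (Finset.coe_subset.2 hIJ)).congr fun v hv => (pos_eq v hv).symm
  have mem : ∀ v ∈ I, posIn (f v) v ∈ Finset.Icc 1 (indepNum G) := by
    intro v hv
    obtain ⟨-, hcard, hmem⟩ := hf v hv
    exact Finset.mem_Icc.2 ⟨Nat.succ_pos _, hcard ▸ posIn_le_card hmem⟩
  refine ⟨inj, mem, ?_⟩
  have avoided : (Finset.Icc 1 (indepNum G)).filter (fun g => ∀ v ∈ I, posIn (f v) v ≠ g) =
      Finset.Icc 1 (indepNum G) \ I.image fun v => posIn (f v) v := by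
    ext g
    simp
  rw [avoided, Finset.card_sdiff_of_subset (Finset.image_subset_iff.2 mem),
    Finset.card_image_of_injOn inj, Nat.card_Icc, hIcard]
  omega
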